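/- (Theorem on transition probability asymptotics.) Let D be a deck of n cards with n_v cards of each value v, D' a reordering of D, and let N be the number of reorderings of D. Define P_a(D→D') = (1/a^n) Σ_{π ∈ T(D,D')} C(a+n-des(π)-1, n). Then P_a(D→D') = 1/N + c_1(D,D')·a^{-1} + O(a^{-2}) as a → ∞, where c_1(D,D') = (n/(2N)) Σ_{u<v} W(D,u,v)·Z(D',u,v)/(n_u·n_v). -/

import Mathlib

open scoped Classical

/-- `W D u v`: number of u-v digraphs minus number of v-u digraphs in deck `D`. -/
noncomputable def Wdig {n : ℕ} {V : Type*} (D : Fin n → V) (u v : V) : ℤ :=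
  ((Finset.univ.filter
      (fun i : Fin n => ∃ h : i.1 + 1 < n, D i = u ∧ D ⟨i.1 + 1, h⟩ = v)).card : ℤ) -
  ((Finset.univ.filter
      (fun i : Fin n => ∃ h : i.1 + 1 < n, D i = v ∧ D ⟨i.1 + 1, h⟩ = u)).card : ℤ)

/-- `Z D u v`: number of u-v pairs minus number of v-u pairs in deck `D`. -/
noncomputable def Zpair {n : ℕ} {V : Type*} (D : Fin n → V) (u v : V) : ℤ :=
  ((Finset.univ.filter
      (fun p : Fin n × Fin n => p.1 < p.2 ∧ D p.1 = u ∧ D p.2 = v)).card : ℤ) -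
  ((Finset.univ.filter
      (fun p : Fin n × Fin n => p.1 < p.2 ∧ D p.1 = v ∧ D p.2 = u)).card : ℤ)
/-- Number of descents of a permutation of `Fin n`. -/
noncomputable def des {n : ℕ} (π : Equiv.Perm (Fin n)) : ℕ :=
  (Finset.univ.filter
    (fun i : Fin n => ∃ h : i.1 + 1 < n, π i > π ⟨i.1 + 1, h⟩)).card

/-- First-order expansion of `∏ (1 + b j / a)` for large `a`. -/
theorem exists_prod_one_add_div_bound {ι : Type*} (s : Finset ι) (b : ι → ℝ) :
    ∃ C : ℝ, ∀ a : ℝ, 1 ≤ a →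
      |∏ j ∈ s, (1 + b j / a) - 1 - (∑ j ∈ s, b j) / a| ≤ C / a ^ 2 := by
  induction s using Finset.induction_on with
  | empty => exact ⟨0, fun a _ => by simp⟩
  | insert k s hk ih =>
    obtain ⟨C, hC⟩ := ih
    refine ⟨|b k * ∑ j ∈ s, b j| + (1 + |b k|) * C, fun a ha => ?_⟩
    have ha0 : 0 < a := by linarith
    rw [Finset.prod_insert hk, Finset.sum_insert hk]
    set P := ∏ j ∈ s, (1 + b j / a)
    set S := ∑ j ∈ s, b j
    have hr := hC a ha
    have key : (1 + b k / a) * P - 1 - (b k + S) / a =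
        b k * S / a ^ 2 + (1 + b k / a) * (P - 1 - S / a) := by
      field_simp
      ring
    have hb : |1 + b k / a| ≤ 1 + |b k| := by
      refine (abs_add_le _ _).trans ?_
      rw [abs_one, abs_div, abs_of_pos ha0]
      gcongr
      exact div_le_self (abs_nonneg _) ha
    rw [key, add_div, mul_div_assoc (1 + |b k|)]
    refine (abs_add_le _ _).trans (add_le_add ?_ ?_)
    · rw [abs_div, abs_of_pos (pow_pos ha0 2)]
    · rw [abs_mul]
      exact mul_le_mul hb hr (abs_nonneg _) (by positivity)

/-- First-order expansion of the number of `a`-shuffles giving a permutation with `d` descents. -/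
theorem exists_choose_div_pow_bound (m d : ℕ) (hd : d ≤ m) :
    ∃ C : ℝ, ∀ a : ℕ, 1 ≤ a →
      |((a + (m + 1) - d - 1).choose (m + 1) : ℝ) / (a : ℝ) ^ (m + 1) - 1 / ((m + 1).factorial : ℝ)
        - ((m + 1 : ℝ) / (2 * ((m + 1).factorial : ℝ)) * (m - 2 * d)) / a| ≤ C / (a : ℝ) ^ 2 := by
  obtain ⟨C, hC⟩ := exists_prod_one_add_div_bound (Finset.range (m + 1))
    (fun j => (m : ℝ) - d - j)
  refine ⟨C / ((m + 1).factorial : ℝ), fun a ha => ?_⟩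
  have ha1 : (1 : ℝ) ≤ a := by exact_mod_cast ha
  have ha0 : (0 : ℝ) < a := by linarith
  have hf : (0 : ℝ) < ((m + 1).factorial : ℝ) := by positivity
  have hcast : ((a + (m + 1) - d - 1 : ℕ) : ℝ) = a + m - d := by
    have : a + (m + 1) - d - 1 + d = a + m := by omega
    rw [eq_sub_iff_add_eq]
    exact_mod_cast this
  have hsum : ∑ j ∈ Finset.range (m + 1), ((m : ℝ) - d - j) = (m + 1) / 2 * (m - 2 * d) := by
    have h := Finset.sum_range_id_mul_two (m + 1)
    rw [Nat.add_sub_cancel] at h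
    have h' : (∑ j ∈ Finset.range (m + 1), (j : ℝ)) * 2 = (m + 1) * m := by
      have := congrArg (Nat.cast : ℕ → ℝ) h
      push_cast at this
      exact this
    rw [Finset.sum_sub_distrib]
    simp only [Finset.sum_const, Finset.card_range, nsmul_eq_mul]
    push_cast
    linarith
  have hprod : ((a + (m + 1) - d - 1).choose (m + 1) : ℝ) / (a : ℝ) ^ (m + 1) =
      (∏ j ∈ Finset.range (m + 1), (1 + ((m : ℝ) - d - j) / a)) / ((m + 1).factorial : ℝ) := by
    rw [Nat.cast_choose_eq_descPochhammer_div ℝ, descPochhammer_eval_eq_prod_range, hcast,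
      div_right_comm]
    congr 1
    conv_lhs => rw [← Finset.card_range (m + 1), ← Finset.prod_const, Finset.card_range,
      ← Finset.prod_div_distrib]
    refine Finset.prod_congr rfl fun j _ => ?_
    field_simp
    ring
  have h := hC a ha1
  rw [hsum] at h
  rw [hprod, show ∀ P : ℝ, P / ((m + 1).factorial : ℝ) - 1 / ((m + 1).factorial : ℝ)
    - ((m + 1 : ℝ) / (2 * ((m + 1).factorial : ℝ)) * (m - 2 * d)) / a =
    (P - 1 - (m + 1) / 2 * (m - 2 * d) / a) / ((m + 1).factorial : ℝ) from
      fun P => by field_simp, abs_div, abs_of_pos hf, div_right_comm]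
  gcongr

/-- Counting positions `i` with `i + 1 < m + 1` is counting over `Fin m`. -/
theorem card_filter_exists_succ {m : ℕ} (P : Fin (m + 1) → Fin (m + 1) → Prop) :
    (Finset.univ.filter (fun i : Fin (m + 1) => ∃ h : i.1 + 1 < m + 1, P i ⟨i.1 + 1, h⟩)).card =
      ∑ i : Fin m, if P i.castSucc i.succ then 1 else 0 := by
  rw [Finset.card_filter, Fin.sum_univ_castSucc]
  simp [Fin.succ]

/-- The antisymmetric comparison sign of two elements. -/
noncomputable def cmpSign {n : ℕ} (p q : Fin n) : ℝ :=
  (if p < q then 1 else 0) - (if q < p then 1 else 0)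

theorem cmpSign_swap {n : ℕ} (p q : Fin n) : cmpSign q p = -cmpSign p q := by
  simp [cmpSign]

theorem cmpSign_eq_of_ne {n : ℕ} {p q : Fin n} (h : p ≠ q) :
    cmpSign p q = 1 - 2 * (if q < p then 1 else 0) := by
  rcases lt_or_gt_of_ne h with h | h
  · simp [cmpSign, h, h.not_gt]
  · simp [cmpSign, h, h.not_gt]
    norm_num

theorem des_eq_sum {m : ℕ} (π : Equiv.Perm (Fin (m + 1))) :
    des π = ∑ i : Fin m, if π i.succ < π i.castSucc then 1 else 0 := by
  rw [des]
  convert card_filter_exists_succ (fun i j => π j < π i)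

theorem des_le {m : ℕ} (π : Equiv.Perm (Fin (m + 1))) : des π ≤ m := by
  rw [des_eq_sum]
  refine (Finset.sum_le_card_nsmul _ _ 1 fun i _ => ?_).trans (by simp)
  split_ifs <;> simp

theorem sum_cmpSign_perm {m : ℕ} (π : Equiv.Perm (Fin (m + 1))) :
    ∑ i : Fin m, cmpSign (π i.castSucc) (π i.succ) = m - 2 * des π := by
  have h : ∀ i : Fin m, π i.castSucc ≠ π i.succ := fun i =>
    π.injective.ne (Fin.castSucc_lt_succ).ne
  simp_rw [fun i => cmpSign_eq_of_ne (h i), des_eq_sum]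
  rw [Finset.sum_sub_distrib, ← Finset.mul_sum]
  simp

theorem Zpair_eq_sum {n : ℕ} {V : Type*} (D : Fin n → V) (u v : V) :
    (Zpair D u v : ℝ) = ∑ p : Fin n × Fin n,
      if D p.1 = u ∧ D p.2 = v then cmpSign p.1 p.2 else 0 := by
  have h : (Finset.univ.filter
      (fun p : Fin n × Fin n => p.1 < p.2 ∧ D p.1 = v ∧ D p.2 = u)).card =
      (Finset.univ.filter
        (fun p : Fin n × Fin n => p.2 < p.1 ∧ D p.1 = u ∧ D p.2 = v)).card :=
    Finset.card_equiv (Equiv.prodComm _ _) fun p => by simp [and_comm]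
  rw [Zpair, h, Finset.card_filter, Finset.card_filter]
  push_cast
  rw [← Finset.sum_sub_distrib]
  refine Finset.sum_congr rfl fun p _ => ?_
  by_cases h : D p.1 = u ∧ D p.2 = v <;> simp [h, cmpSign]

theorem Zpair_swap {n : ℕ} {V : Type*} (D : Fin n → V) (u v : V) :
    Zpair D v u = -Zpair D u v := by
  simp [Zpair]

theorem Zpair_self {n : ℕ} {V : Type*} (D : Fin n → V) (u : V) : Zpair D u u = 0 := by
  simp [Zpair]

theorem Wdig_eq_sum {m : ℕ} {V : Type*} (D : Fin (m + 1) → V) (u v : V) :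
    (Wdig D u v : ℝ) = ∑ i : Fin m,
      ((if D i.castSucc = u ∧ D i.succ = v then 1 else 0) -
        (if D i.castSucc = v ∧ D i.succ = u then 1 else 0)) := by
  have h : ∀ x y : V, (Finset.univ.filter (fun i : Fin (m + 1) =>
      ∃ h : i.1 + 1 < m + 1, D i = x ∧ D ⟨i.1 + 1, h⟩ = y)).card =
      ∑ i : Fin m, if D i.castSucc = x ∧ D i.succ = y then 1 else 0 := fun x y => by
    convert card_filter_exists_succ (fun i j => D i = x ∧ D j = y)
  rw [Wdig, h, h, Finset.sum_sub_distrib]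
  push_cast
  rfl

/-- The permutations carrying the deck `D` to the deck `D'`. -/
noncomputable def carriers {n : ℕ} {V : Type*} (D D' : Fin n → V) :
    Finset (Equiv.Perm (Fin n)) :=
  Finset.univ.filter (fun π => ∀ i, D' (π i) = D i)

theorem mem_carriers {n : ℕ} {V : Type*} {D D' : Fin n → V} {π : Equiv.Perm (Fin n)} :
    π ∈ carriers D D' ↔ ∀ i, D' (π i) = D i := by
  simp [carriers]

/-- Right multiplication by a permutation preserving `D` permutes the carriers from `D`. -/
theorem sum_carriers_mul_right {n : ℕ} {V : Type*} {D D' : Fin n → V} (τ : Equiv.Perm (Fin n))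
    (hτ : ∀ i, D (τ i) = D i) (F : Equiv.Perm (Fin n) → ℝ) :
    ∑ π ∈ carriers D D', F (π * τ) = ∑ π ∈ carriers D D', F π := by
  refine Finset.sum_equiv (Equiv.mulRight τ) (fun π => ?_) fun π _ => rfl
  simp only [mem_carriers, Equiv.coe_mulRight, Equiv.Perm.mul_apply]
  constructor
  · intro h i
    rw [h, hτ]
  · intro h i
    have := h (τ.symm i)
    rwa [← hτ, τ.apply_symm_apply] at this

theorem comp_swap_of_eq {n : ℕ} {V : Type*} {D : Fin n → V} {i j : Fin n} (h : D i = D j)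
    (k : Fin n) : D (Equiv.swap i j k) = D k := by
  rw [Equiv.swap_apply_def]
  split_ifs with h1 h2
  · rw [h1, h]
  · rw [h2, h]
  · rfl

theorem card_carriers_comp_symm {n : ℕ} {V : Type*} (D : Fin n → V) (σ τ : Equiv.Perm (Fin n)) :
    (carriers D (D ∘ ⇑σ.symm)).card = (carriers D (D ∘ ⇑τ.symm)).card := by
  refine Finset.card_equiv (Equiv.mulLeft (τ * σ⁻¹)) fun π => ?_
  simp only [mem_carriers, Equiv.coe_mulLeft, Equiv.Perm.mul_apply, Function.comp_apply,
    Equiv.symm_apply_apply, Equiv.Perm.inv_def]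

/-- Orbit-stabilizer for decks. -/
theorem card_reorderings_mul_card_carriers {n : ℕ} {V : Type*} (D : Fin n → V)
    (σ : Equiv.Perm (Fin n)) :
    Nat.card {E : Fin n → V | ∃ π : Equiv.Perm (Fin n), E = D ∘ ⇑π.symm} *
      (carriers D (D ∘ ⇑σ.symm)).card = n.factorial := by
  set R : Finset (Fin n → V) :=
    Finset.univ.image (fun π : Equiv.Perm (Fin n) => D ∘ ⇑π.symm) with hR
  have hN : Nat.card {E : Fin n → V | ∃ π : Equiv.Perm (Fin n), E = D ∘ ⇑π.symm} = R.card := by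
    rw [← Nat.card_eq_finsetCard]
    refine Nat.card_congr (Equiv.setCongr (t := (R : Set (Fin n → V))) ?_)
    ext E
    simp [hR, eq_comm]
  have hcard := Finset.card_eq_sum_card_fiberwise (s := Finset.univ) (t := R)
    (f := fun π : Equiv.Perm (Fin n) => D ∘ ⇑π.symm) (fun π _ => by simp [hR])
  rw [Finset.card_univ, Fintype.card_perm, Fintype.card_fin] at hcard
  rw [hN, hcard, Finset.sum_const_nat]
  intro E hE
  obtain ⟨τ, -, rfl⟩ := Finset.mem_image.1 hE
  rw [card_carriers_comp_symm D σ τ]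
  congr 1
  ext π
  simp only [mem_carriers, Finset.mem_filter, Finset.mem_univ, true_and, funext_iff,
    Function.comp_apply]
  constructor
  · intro h i
    simpa using (h (π i)).symm
  · intro h i
    simpa using (h (π.symm i)).symm

/-- Under a uniformly random carrier, two positions holding equal cards are exchangeable. -/
theorem sum_cmpSign_carriers_of_eq {n : ℕ} {V : Type*} {D D' : Fin n → V} {i j : Fin n}
    (h : D i = D j) : ∑ π ∈ carriers D D', cmpSign (π i) (π j) = 0 := by
  have := sum_carriers_mul_right (D' := D') (Equiv.swap i j) (comp_swap_of_eq h)
    (fun π => cmpSign (π i) (π j))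
  simp only [Equiv.Perm.mul_apply, Equiv.swap_apply_left, Equiv.swap_apply_right] at this
  rw [Finset.sum_congr rfl fun π _ => cmpSign_swap (π i) (π j), Finset.sum_neg_distrib] at this
  linarith

/-- Under a uniformly random carrier, the images of two positions holding distinct cards are
uniformly distributed. -/
theorem sum_cmpSign_carriers_of_ne {n : ℕ} {V : Type*} {D D' : Fin n → V} {i j : Fin n}
    (h : D i ≠ D j) :
    ((Finset.univ.filter (fun k => D k = D i)).card : ℝ) *
      ((Finset.univ.filter (fun k => D k = D j)).card : ℝ) *
      ∑ π ∈ carriers D D', cmpSign (π i) (π j) =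
    (carriers D D').card * (Zpair D' (D i) (D j) : ℝ) := by
  have hconst : ∀ k l, D k = D i → D l = D j →
      ∑ π ∈ carriers D D', cmpSign (π k) (π l) = ∑ π ∈ carriers D D', cmpSign (π i) (π j) := by
    intro k l hk hl
    have := sum_carriers_mul_right (D' := D') (Equiv.swap i k * Equiv.swap j l)
      (fun x => (comp_swap_of_eq hk.symm _).trans (comp_swap_of_eq hl.symm x))
      (fun π => cmpSign (π i) (π j))
    rw [← this]
    have hij : i ≠ j := fun e => h (by rw [e])
    have hil : i ≠ l := fun e => h (by rw [e, hl])
    have hlk : l ≠ k := fun e => h (by rw [← hk, ← e, hl])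
    simp [Equiv.swap_apply_of_ne_of_ne, hij, hil, hil.symm, hlk]
  have hz : ∀ π ∈ carriers D D', (Zpair D' (D i) (D j) : ℝ) =
      ∑ p : Fin n × Fin n,
        if D p.1 = D i ∧ D p.2 = D j then cmpSign (π p.1) (π p.2) else 0 := by
    intro π hπ
    rw [mem_carriers] at hπ
    rw [Zpair_eq_sum, ← Equiv.sum_comp (π.prodCongr π)]
    simp [hπ]
  rw [← nsmul_eq_mul (carriers D D').card, ← Finset.sum_const, Finset.sum_congr rfl hz,
    Finset.sum_comm, ← Nat.cast_mul, ← Finset.card_product, ← nsmul_eq_mul, ← Finset.sum_const,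
    ← Finset.filter_product, Finset.univ_product_univ, Finset.sum_filter]
  refine Finset.sum_congr rfl fun p _ => ?_
  split_ifs with hp
  · exact (hconst _ _ hp.1 hp.2).symm
  · simp

/-- A sum over ordered pairs of an antisymmetric function against an antisymmetrized indicator. -/
theorem sum_lt_indicator_mul {V : Type*} [Fintype V] [LinearOrder V] (g : V → V → ℝ)
    (hg : ∀ u v, g v u = -g u v) (x y : V) :
    ∑ p ∈ Finset.univ.filter (fun p : V × V => p.1 < p.2),
      ((if x = p.1 ∧ y = p.2 then 1 else 0) - (if x = p.2 ∧ y = p.1 then 1 else 0)) * g p.1 p.2 =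
      g x y := by
  have h1 : ∀ p : V × V, (x = p.1 ∧ y = p.2) ↔ p = (x, y) := fun p => by
    rw [Prod.ext_iff]; simp [eq_comm]
  have h2 : ∀ p : V × V, (x = p.2 ∧ y = p.1) ↔ p = (y, x) := fun p => by
    rw [Prod.ext_iff]; simp [eq_comm, and_comm]
  simp only [h1, h2, sub_mul, Finset.sum_sub_distrib, ite_mul, one_mul, zero_mul,
    Finset.sum_ite_eq', Finset.mem_filter, Finset.mem_univ, true_and]
  rcases lt_trichotomy x y with h | h | h
  · simp [h, h.not_gt]
  · subst h
    have := hg x x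
    simp
    linarith
  · simp [h, h.not_gt, hg x y]

/-- The sum of `m - 2 * des π` over the carriers, through digraphs and pairs. -/
theorem sum_carriers_sub_des {V : Type*} [Fintype V] [LinearOrder V] {m : ℕ}
    (D D' : Fin (m + 1) → V) :
    ∑ π ∈ carriers D D', ((m : ℝ) - 2 * des π) = (carriers D D').card *
      ∑ p ∈ Finset.univ.filter (fun p : V × V => p.1 < p.2),
        (Wdig D p.1 p.2 : ℝ) * (Zpair D' p.1 p.2 : ℝ) /
          (((Finset.univ.filter (fun i => D i = p.1)).card : ℝ) *
            ((Finset.univ.filter (fun i => D i = p.2)).card : ℝ)) := by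
  set c : V → ℝ := fun v => ((Finset.univ.filter (fun i => D i = v)).card : ℝ) with hc
  have hc0 : ∀ i, c (D i) ≠ 0 := fun i => by
    simp only [hc, Nat.cast_ne_zero]
    exact Finset.card_ne_zero_of_mem (a := i) (by simp)
  set g : V → V → ℝ := fun u v => (Zpair D' u v : ℝ) / (c u * c v) with hgdef
  have hg : ∀ u v, g v u = -g u v := fun u v => by
    simp only [hgdef, Zpair_swap D' u v]
    push_cast
    rw [mul_comm (c v), neg_div]
  have hlocal : ∀ i j : Fin (m + 1), ∑ π ∈ carriers D D', cmpSign (π i) (π j) =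
      (carriers D D').card * g (D i) (D j) := by
    intro i j
    by_cases h : D i = D j
    · rw [sum_cmpSign_carriers_of_eq h, h]
      simp [hgdef, Zpair_self]
    · have := sum_cmpSign_carriers_of_ne (D' := D') h
      have h1 := hc0 i
      have h2 := hc0 j
      simp only [hgdef]
      rw [← mul_div_assoc, eq_div_iff (mul_ne_zero h1 h2), ← this, mul_comm]
      simp only [hc]
      congr!
  have hW : ∀ p : V × V, (Wdig D p.1 p.2 : ℝ) * (Zpair D' p.1 p.2 : ℝ) / (c p.1 * c p.2) =
      ∑ i : Fin m, ((if D i.castSucc = p.1 ∧ D i.succ = p.2 then 1 else 0) -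
        (if D i.castSucc = p.2 ∧ D i.succ = p.1 then 1 else 0)) * g p.1 p.2 := by
    intro p
    rw [mul_div_assoc, Wdig_eq_sum, Finset.sum_mul]
    congr!
  simp_rw [← sum_cmpSign_perm]
  refine Eq.trans ?_ (congrArg _ (Finset.sum_congr rfl fun p _ => (hW p).symm))
  rw [Finset.sum_comm, Finset.sum_comm (s := Finset.univ.filter _), Finset.mul_sum]
  refine Finset.sum_congr rfl fun i _ => ?_
  rw [hlocal, sum_lt_indicator_mul g hg]

/-- Transition probability asymptotics: if `D'` is a reordering of `D` then
`P_a(D → D') = 1/N + c₁(D,D')·a⁻¹ + O(a⁻²)`, where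
`c₁(D,D') = (n/(2N)) ∑_{u<v} W(D,u,v)·Z(D',u,v)/(n_u·n_v)`. -/
theorem transition_prob_asymptotics {V : Type*} [Fintype V] [LinearOrder V]
    (n : ℕ) (D : Fin n → V) (σ : Equiv.Perm (Fin n)) (D' : Fin n → V)
    (hD' : D' = D ∘ ⇑σ.symm) :
    ∃ C : ℝ, ∀ a : ℕ, 1 ≤ a →
      let N : ℕ :=
        Nat.card {E : Fin n → V | ∃ π : Equiv.Perm (Fin n), E = D ∘ ⇑π.symm}
      let nv : V → ℕ := fun v => (Finset.univ.filter (fun i : Fin n => D i = v)).card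
      let c1 : ℝ := ((n : ℝ) / (2 * (N : ℝ))) *
        ∑ p ∈ Finset.univ.filter (fun p : V × V => p.1 < p.2),
          (Wdig D p.1 p.2 : ℝ) * (Zpair D' p.1 p.2 : ℝ) /
            ((nv p.1 : ℝ) * (nv p.2 : ℝ))
      |((1 / (a : ℝ) ^ n) *
            ∑ π ∈ Finset.univ.filter
                (fun π : Equiv.Perm (Fin n) => ∀ i, D' (π i) = D i),
              ((a + n - des π - 1).choose n : ℝ))
          - 1 / (N : ℝ) - c1 / (a : ℝ)| ≤ C / (a : ℝ) ^ 2 := by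
  have hNT := card_reorderings_mul_card_carriers D σ
  rw [← hD'] at hNT
  cases n with
  | zero =>
    refine ⟨0, fun a ha => ?_⟩
    have hN := (mul_eq_one.1 (hNT.trans Nat.factorial_zero)).1
    simp only [hN]
    simp
  | succ m =>
    choose C hC using fun π : Equiv.Perm (Fin (m + 1)) =>
      exists_choose_div_pow_bound m (des π) (des_le π)
    refine ⟨∑ π ∈ carriers D D', C π, fun a ha => ?_⟩
    intro N nv c1
    have hf : ((m + 1).factorial : ℝ) ≠ 0 := by positivity
    have hNT' : (N : ℝ) * (carriers D D').card = (m + 1).factorial := by exact_mod_cast hNT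
    have hinv : 1 / (N : ℝ) = (carriers D D').card * (1 / ((m + 1).factorial : ℝ)) := by
      rw [← hNT'] at hf ⊢
      have := right_ne_zero_of_mul hf
      field_simp
    have hc1 : c1 = ∑ π ∈ carriers D D',
        (m + 1 : ℝ) / (2 * ((m + 1).factorial : ℝ)) * (m - 2 * des π) := by
      rw [← Finset.mul_sum, sum_carriers_sub_des, ← mul_assoc]
      have : ((m + 1 : ℕ) : ℝ) / (2 * (N : ℝ)) =
          (m + 1 : ℝ) / (2 * ((m + 1).factorial : ℝ)) * (carriers D D').card := by
        rw [← hNT'] at hf ⊢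
        have := right_ne_zero_of_mul hf
        push_cast
        field_simp
      simp only [c1, nv, this]
    have hexp : (1 / (a : ℝ) ^ (m + 1)) * ∑ π ∈ carriers D D',
          ((a + (m + 1) - des π - 1).choose (m + 1) : ℝ) - 1 / (N : ℝ) - c1 / (a : ℝ) =
        ∑ π ∈ carriers D D',
          (((a + (m + 1) - des π - 1).choose (m + 1) : ℝ) / (a : ℝ) ^ (m + 1)
            - 1 / ((m + 1).factorial : ℝ)
            - ((m + 1 : ℝ) / (2 * ((m + 1).factorial : ℝ)) * (m - 2 * des π)) / a) := by
      rw [Finset.sum_sub_distrib, Finset.sum_sub_distrib, Finset.sum_const, nsmul_eq_mul,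
        ← Finset.sum_div, ← Finset.sum_div, ← hc1, hinv, one_div_mul_eq_div]
    have hgoal := (congrArg abs hexp).le.trans ((Finset.abs_sum_le_sum_abs _ _).trans
      (Finset.sum_le_sum fun π _ => hC π a ha))
    rw [← Finset.sum_div] at hgoal
    rw [show Finset.univ.filter (fun π : Equiv.Perm (Fin (m + 1)) => ∀ i, D' (π i) = D i) =
      carriers D D' by ext; simp [carriers]]
    exact hgoal
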